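/- 12·β̃ lies in ℤ[ζ_f, φ], the subring of ℂ generated by ℤ, the primitive f-th root of unity ζ_f := e^{2πi/f}, and the values of φ; in particular 12·β̃ is an algebraic integer. -/

import Mathlib

open scoped BigOperators Real

/-- The Gauss sum `τ(ψ) = Σ_{a=0}^{c−1} ψ(a)·e^{2πia/c}` of a Dirichlet character mod `c`. -/
noncomputable def gaussSum' (c : ℕ) (ψ : DirichletCharacter ℂ c) : ℂ :=
  ∑ a ∈ Finset.range c, ψ ((a : ℕ) : ZMod c) * Complex.exp (2 * (π : ℂ) * Complex.I * a / c)

/-- The second generalized Bernoulli number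
`B₂(ψ) = c·Σ_{a=0}^{c−1} ψ(a)·((a/c)² − a/c + 1/6)` of a Dirichlet character mod `c`. -/
noncomputable def B2 (c : ℕ) (ψ : DirichletCharacter ℂ c) : ℂ :=
  (c : ℂ) * ∑ a ∈ Finset.range c,
    ψ ((a : ℕ) : ZMod c) * (((a : ℂ) / c) ^ 2 - (a : ℂ) / c + 1 / 6)


/-- A sum over `range c` of a function of the residue is the sum over `ZMod c`. -/
lemma sum_range_zmod (c : ℕ) [NeZero c] (g : ZMod c → ℂ) :
    ∑ a ∈ Finset.range c, g ((a : ℕ) : ZMod c) = ∑ a : ZMod c, g a := by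
  refine Finset.sum_bij' (fun a _ => ((a : ℕ) : ZMod c)) (fun a _ => a.val) ?_ ?_ ?_ ?_ ?_
  · intro a _; exact Finset.mem_univ _
  · intro a _; exact Finset.mem_range.2 (ZMod.val_lt a)
  · intro a ha; exact ZMod.val_cast_of_lt (Finset.mem_range.1 ha)
  · intro a _; exact ZMod.natCast_zmod_val a
  · intro a _; rfl

lemma gaussSum'_eq (c : ℕ) [NeZero c] (ψ : DirichletCharacter ℂ c) :
    gaussSum' c ψ = gaussSum ψ ZMod.stdAddChar := by
  unfold gaussSum' gaussSum
  rw [← sum_range_zmod c (fun a => ψ a * ZMod.stdAddChar a)]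
  refine Finset.sum_congr rfl fun a _ => ?_
  congr 1
  have := ZMod.stdAddChar_coe (N := c) (a : ℤ)
  push_cast at this
  exact this.symm

open scoped ZMod in
lemma tau_mul (n : ℕ) [NeZero n] (χ : DirichletCharacter ℂ n) (h : χ.IsPrimitive) :
    χ⁻¹ (-1) * gaussSum' n χ * gaussSum' n χ⁻¹ = n := by
  have h1 := congrFun (ZMod.dft_dft (N := n) (χ : ZMod n → ℂ)) (-1)
  have h2 : ZMod.dft (N := n) (χ : ZMod n → ℂ)
      = fun k => χ⁻¹ (-k) * gaussSum χ ZMod.stdAddChar :=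
    funext fun k => h.fourierTransform_eq_inv_mul_gaussSum k
  rw [h2, ZMod.dft_apply] at h1
  simp only [neg_neg, map_one, smul_eq_mul, mul_one, mul_neg] at h1
  rw [gaussSum'_eq, gaussSum'_eq, ← h1]
  conv_lhs => rw [gaussSum.eq_def χ⁻¹]
  rw [Finset.mul_sum]
  refine Finset.sum_congr rfl fun j _ => ?_
  rw [show (-j : ZMod n) = (-1) * j by ring, map_mul]
  ring

lemma gauss_mem (R : Subring ℂ) (c : ℕ) (ψ : DirichletCharacter ℂ c)
    (hψ : ∀ a, ψ a ∈ R) (hz : Complex.exp (2 * (π : ℂ) * Complex.I / c) ∈ R) :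
    gaussSum' c ψ ∈ R := by
  refine R.sum_mem fun a _ => R.mul_mem (hψ _) ?_
  have : Complex.exp (2 * (π : ℂ) * Complex.I * a / c)
      = Complex.exp (2 * (π : ℂ) * Complex.I / c) ^ a := by
    rw [← Complex.exp_nat_mul]; congr 1; ring
  rw [this]
  exact R.pow_mem hz a

lemma inv_mem (R : Subring ℂ) (c : ℕ) (ψ : DirichletCharacter ℂ c)
    (hψ : ∀ a, ψ a ∈ R) (a : ZMod c) : ψ⁻¹ a ∈ R := by
  rw [MulChar.inv_apply]; exact hψ _

lemma xi_mem (R : Subring ℂ) (f n : ℕ) (hf : 1 < f) (φ : DirichletCharacter ℂ f)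
    (hn : n ∣ f) (ξ : DirichletCharacter ℂ n)
    (hξ : φ ^ 2 = DirichletCharacter.changeLevel hn ξ)
    (hφ : ∀ a, φ a ∈ R) (a : ZMod n) : ξ a ∈ R := by
  have : NeZero f := ⟨by omega⟩
  by_cases ha : IsUnit a
  · obtain ⟨u, rfl⟩ := ha
    obtain ⟨v, rfl⟩ := ZMod.unitsMap_surjective hn u
    have h := DirichletCharacter.changeLevel_eq_cast_of_dvd ξ hn v
    rw [← hξ] at h
    rw [ZMod.unitsMap_val, ← h, MulChar.pow_apply_coe]
    exact R.pow_mem (hφ _) 2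
  · rw [MulChar.map_nonunit _ ha]; exact R.zero_mem

lemma nB2_mem (R : Subring ℂ) (n : ℕ) (hn1 : 1 < n) (χ : DirichletCharacter ℂ n)
    (hχ1 : χ ≠ 1) (hχ : ∀ a, χ a ∈ R) : (n : ℂ) * B2 n χ ∈ R := by
  have : NeZero n := ⟨by omega⟩
  have hn0 : (n : ℂ) ≠ 0 := NeZero.ne _
  have h0 : ∑ a ∈ Finset.range n, χ ((a : ℕ) : ZMod n) = 0 := by
    rw [sum_range_zmod n (fun a => χ a)]
    exact MulChar.sum_eq_zero_of_ne_one hχ1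
  have : (n : ℂ) * B2 n χ = ∑ a ∈ Finset.range n,
      χ ((a : ℕ) : ZMod n) * ((a : ℂ) ^ 2 - a * n) := by
    have e : ∑ a ∈ Finset.range n, χ ((a : ℕ) : ZMod n) * ((a : ℂ) ^ 2 - a * n)
      = ∑ a ∈ Finset.range n, χ ((a : ℕ) : ZMod n) * ((a : ℂ) ^ 2 - a * n)
        + (n : ℂ) ^ 2 / 6 * ∑ a ∈ Finset.range n, χ ((a : ℕ) : ZMod n) := by
      rw [h0]; ring
    rw [e, B2, Finset.mul_sum, Finset.mul_sum, Finset.mul_sum, ← Finset.sum_add_distrib]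
    refine Finset.sum_congr rfl fun a _ => ?_
    field_simp
  rw [this]
  refine R.sum_mem fun a _ => R.mul_mem (hχ _) (R.sub_mem (R.pow_mem (natCast_mem R a) 2)
    (R.mul_mem (natCast_mem R a) (natCast_mem R n)))

lemma B2_one (χ : DirichletCharacter ℂ 1) : B2 1 χ = 1 / 6 := by
  have : χ 0 = 1 := by
    rw [Subsingleton.elim (0 : ZMod 1) 1, map_one]
  simp [B2, this]

/-- Clearing denominators in an Euler product. -/
lemma euler_clear (A : Finset ℕ) (hA : ∀ p ∈ A, p.Prime) (g : ℕ → ℂ) :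
    ((∏ p ∈ A, p : ℕ) : ℂ) ^ 2 * ∏ p ∈ A, (1 - g p / (p : ℂ) ^ 2)
      = ∏ p ∈ A, ((p : ℂ) ^ 2 - g p) := by
  rw [Nat.cast_prod, ← Finset.prod_pow, ← Finset.prod_mul_distrib]
  refine Finset.prod_congr rfl fun p hp => ?_
  have : (p : ℂ) ≠ 0 := Nat.cast_ne_zero.2 (hA p hp).ne_zero
  field_simp

lemma even_part (f : ℕ) (hf : 1 < f) :
    (2 : ℤ) ∣ (f : ℤ) * ∏ p ∈ f.primeFactors, ((p : ℤ) ^ 2 - 1) := by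
  rcases Nat.even_or_odd f with h | h
  · exact Dvd.dvd.mul_right (by exact_mod_cast h.two_dvd) _
  · refine Dvd.dvd.mul_left ?_ _
    have hp : f.minFac ∈ f.primeFactors :=
      Nat.mem_primeFactors.2 ⟨Nat.minFac_prime (by omega), Nat.minFac_dvd f, by omega⟩
    refine dvd_trans ?_ (Finset.dvd_prod_of_mem _ hp)
    have ho : Odd (f.minFac : ℤ) := by
      exact_mod_cast Odd.of_dvd_nat h (Nat.minFac_dvd f)
    exact (ho.pow.sub_odd odd_one).two_dvd

lemma closure_integral (f : ℕ) (hf : 1 < f) (φ : DirichletCharacter ℂ f) (x : ℂ)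
    (hx : x ∈ Subring.closure
      ({Complex.exp (2 * (π : ℂ) * Complex.I / f)} ∪
        Set.range (fun a : ZMod f => φ a))) : IsIntegral ℤ x := by
  have : NeZero f := ⟨by omega⟩
  have : Subring.closure
      ({Complex.exp (2 * (π : ℂ) * Complex.I / f)} ∪
        Set.range (fun a : ZMod f => φ a)) ≤ (integralClosure ℤ ℂ).toSubring := by
    rw [Subring.closure_le]
    rintro y (hy | ⟨a, rfl⟩)
    · rw [Set.mem_singleton_iff.1 hy]
      change IsIntegral ℤ _
      refine IsIntegral.of_pow (n := f) (by omega) ?_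
      rw [(Complex.isPrimitiveRoot_exp f (by omega)).pow_eq_one]
      exact isIntegral_one
    · change IsIntegral ℤ (φ a)
      by_cases ha : IsUnit a
      · obtain ⟨u, rfl⟩ := ha
        refine IsIntegral.of_pow (n := orderOf u) (orderOf_pos u) ?_
        rw [← map_pow, ← Units.val_pow_eq_pow_val, pow_orderOf_eq_one, Units.val_one, map_one]
        exact isIntegral_one
      · rw [MulChar.map_nonunit _ ha]; exact isIntegral_zero
  exact this hx

lemma final_algebra (n r k T Φ P G H E B X Y : ℂ) (hn : n ≠ 0) :
    12 * ((n * r * k) ^ 4 * T ^ 2 * Φ / (4 * n) * P * (G * (E * H) / n) * B * (X * Y))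
      = (G * H * E * Φ * P * (T ^ 2 * Y) * (r * k ^ 3))
        * (((n * r * k) * (r ^ 2 * X)) * (3 * (n * B))) := by
  field_simp
  ring

/-- `12·β̃` lies in `ℤ[ζ_f, φ]`, the subring of `ℂ` generated by `ℤ`, the primitive `f`-th
root of unity `ζ_f = e^{2πi/f}`, and the values of `φ`; in particular it is an algebraic
integer. Here `β̃ = (f⁴T₁²Φ/(4n))·(∏_{p∣f} p^{ν_p(M)+δ_p})·(τ(φ⁻¹)/τ(ξ⁻¹))·B₂(ξ⁻¹)
·∏_{p∣fT₁}(1 − ξ(p)/p²)`, with `ξ` the primitive character of conductor `n` inducing `φ²`,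
`Φ = ∏_{q ∈ S_φ}(q−1)` where `S_φ = {q ∣ T₂ : φ(q) = ±1}`, and `δ_p = 1` iff `ν_p(M) = 0`
and `ν_p(N/f²) ≥ 1`. -/
theorem twelve_mul_betaTilde_mem
    (f : ℕ) (hf : 1 < f) (φ : DirichletCharacter ℂ f)
    (hφ : φ ≠ 1) (hφprim : φ.IsPrimitive)
    (n : ℕ) (hn : n ∣ f) (ξ : DirichletCharacter ℂ n) (hξprim : ξ.IsPrimitive)
    (hξ : φ ^ 2 = DirichletCharacter.changeLevel hn ξ)
    (N M L : ℕ) (hN : 0 < N) (hM : 0 < M) (hL : 0 < L)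
    (hdvd : f ^ 2 * M * L ∣ N) (hcop : Nat.Coprime (f * M) L)
    (T₁ T₂ : ℕ)
    (hT₁ : T₁ = ∏ l ∈ M.primeFactors.filter (fun l => ¬ l ∣ f), l)
    (hT₂ : T₂ = ∏ q ∈ L.primeFactors, q)
    (Φ : ℂ)
    (hΦ : Φ = ∏ q ∈ T₂.primeFactors.filter
      (fun q => φ ((q : ℕ) : ZMod f) = 1 ∨ φ ((q : ℕ) : ZMod f) = -1), ((q : ℂ) - 1))
    (δ : ℕ → ℕ)
    (hδ : ∀ p : ℕ, δ p = if M.factorization p = 0 ∧ 1 ≤ (N / f ^ 2).factorization p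
      then 1 else 0)
    (β : ℂ)
    (hβ : β = ((f : ℂ) ^ 4 * (T₁ : ℂ) ^ 2 * Φ / (4 * n)) *
      (∏ p ∈ f.primeFactors, (p : ℂ) ^ (M.factorization p + δ p)) *
      (gaussSum' f φ⁻¹ / gaussSum' n ξ⁻¹) * B2 n ξ⁻¹ *
      ∏ p ∈ (f * T₁).primeFactors, (1 - ξ ((p : ℕ) : ZMod n) / (p : ℂ) ^ 2)) :
    12 * β ∈ Subring.closure
      ({Complex.exp (2 * (π : ℂ) * Complex.I / f)} ∪
        Set.range (fun a : ZMod f => φ a)) ∧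
    IsIntegral ℤ (12 * β) := by
  suffices H : 12 * β ∈ Subring.closure
      ({Complex.exp (2 * (π : ℂ) * Complex.I / f)} ∪
        Set.range (fun a : ZMod f => φ a)) from ⟨H, closure_integral f hf φ _ H⟩
  set R := Subring.closure
      ({Complex.exp (2 * (π : ℂ) * Complex.I / f)} ∪
        Set.range (fun a : ZMod f => φ a)) with hR
  have hf0 : f ≠ 0 := by omega
  have hn0 : n ≠ 0 := fun h => hf0 (by rw [h] at hn; exact zero_dvd_iff.1 hn)
  have : NeZero f := ⟨hf0⟩
  have : NeZero n := ⟨hn0⟩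
  have hnC : (n : ℂ) ≠ 0 := Nat.cast_ne_zero.2 hn0
  have hφR : ∀ a, φ a ∈ R := fun a => Subring.subset_closure (Or.inr ⟨a, rfl⟩)
  have hzR : Complex.exp (2 * (π : ℂ) * Complex.I / f) ∈ R :=
    Subring.subset_closure (Or.inl rfl)
  have hξR : ∀ a, ξ a ∈ R := xi_mem R f n hf φ hn ξ hξ hφR
  have hξiR := inv_mem R n ξ hξR
  have hznR : Complex.exp (2 * (π : ℂ) * Complex.I / n) ∈ R := by
    obtain ⟨k, hk⟩ := hn
    have hk0 : (k : ℂ) ≠ 0 := by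
      rintro h
      apply hf0
      rw [hk, Nat.cast_eq_zero.1 h, mul_zero]
    have : Complex.exp (2 * (π : ℂ) * Complex.I / n)
        = Complex.exp (2 * (π : ℂ) * Complex.I / f) ^ k := by
      rw [← Complex.exp_nat_mul, hk]
      congr 1
      push_cast
      field_simp
    rw [this]
    exact R.pow_mem hzR k
  have hg1 := gauss_mem R f φ⁻¹ (inv_mem R f φ hφR) hzR
  have hg2 := gauss_mem R n ξ hξR hznR
  have hτ := tau_mul n ξ hξprim
  have hτ0 : gaussSum' n ξ⁻¹ ≠ 0 := by
    intro h; rw [h, mul_zero] at hτ; exact hnC hτ.symm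
  -- the primes dividing `M` but not `f`
  set S := M.primeFactors.filter (fun l => ¬ l ∣ f) with hS
  have hSp : ∀ p ∈ S, p.Prime := fun p hp =>
    Nat.prime_of_mem_primeFactors (Finset.mem_filter.1 hp).1
  have hT0 : T₁ ≠ 0 := by
    rw [hT₁]; exact Finset.prod_ne_zero_iff.2 fun p hp => (hSp p hp).ne_zero
  have hTpf : T₁.primeFactors = S := by rw [hT₁]; exact Nat.primeFactors_prod hSp
  have hdisj : Disjoint f.primeFactors S := by
    rw [Finset.disjoint_left]
    intro p hp hp'
    exact (Finset.mem_filter.1 hp').2 (Nat.dvd_of_mem_primeFactors hp)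
  set g : ℕ → ℂ := fun p => ξ ((p : ℕ) : ZMod n) with hg
  -- the primes dividing `f` but not `n`
  set A := f.primeFactors.filter (fun p => ¬ p ∣ n) with hA
  have hAp : ∀ p ∈ A, p.Prime := fun p hp =>
    Nat.prime_of_mem_primeFactors (Finset.mem_filter.1 hp).1
  have hprodf : ∏ p ∈ f.primeFactors, (1 - g p / (p : ℂ) ^ 2)
      = ∏ p ∈ A, (1 - g p / (p : ℂ) ^ 2) := by
    refine (Finset.prod_subset (Finset.filter_subset _ _) ?_).symm
    intro p hp hpA
    have hpn : p ∣ n := by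
      by_contra h
      exact hpA (Finset.mem_filter.2 ⟨hp, h⟩)
    have : g p = 0 := by
      refine MulChar.map_nonunit _ ?_
      rw [ZMod.isUnit_iff_coprime]
      intro hc
      exact (Nat.prime_of_mem_primeFactors hp).one_lt.ne'
        (Nat.eq_one_of_dvd_coprimes hc dvd_rfl hpn)
    rw [this, zero_div, sub_zero]
  have hprod : ∏ p ∈ (f * T₁).primeFactors, (1 - ξ ((p : ℕ) : ZMod n) / (p : ℂ) ^ 2)
      = (∏ p ∈ A, (1 - g p / (p : ℂ) ^ 2)) * ∏ p ∈ S, (1 - g p / (p : ℂ) ^ 2) := by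
    rw [Nat.primeFactors_mul hf0 hT0, hTpf, Finset.prod_union hdisj, ← hprodf]
  set r : ℕ := ∏ p ∈ A, p with hr
  have hr0 : (r : ℂ) ≠ 0 :=
    Nat.cast_ne_zero.2 (Finset.prod_ne_zero_iff.2 fun p hp => (hAp p hp).ne_zero)
  have hrf : r ∣ f :=
    (Finset.prod_dvd_prod_of_subset _ _ _ (Finset.filter_subset _ _)).trans
      (Nat.prod_primeFactors_dvd f)
  have hnr : Nat.Coprime n r := by
    refine Nat.Coprime.prod_right fun p hp => ?_
    exact ((hAp p hp).coprime_iff_not_dvd.2 (Finset.mem_filter.1 hp).2).symm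
  obtain ⟨k, hk⟩ := hnr.mul_dvd_of_dvd_of_dvd hn hrf
  have hkC : (f : ℂ) = n * r * k := by exact_mod_cast hk
  have hEA := euler_clear A hAp g
  have hES := euler_clear S hSp g
  rw [← hr] at hEA
  rw [← hT₁] at hES
  have hU : ∀ B : Finset ℕ, ∏ p ∈ B, ((p : ℂ) ^ 2 - g p) ∈ R := fun B =>
    R.prod_mem fun p _ => R.sub_mem (R.pow_mem (natCast_mem R p) 2) (hξR _)
  have hΦR : Φ ∈ R := by
    rw [hΦ]
    exact R.prod_mem fun q _ => R.sub_mem (natCast_mem R q) R.one_mem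
  have hPR : (∏ p ∈ f.primeFactors, (p : ℂ) ^ (M.factorization p + δ p)) ∈ R :=
    R.prod_mem fun p _ => R.pow_mem (natCast_mem R p) _
  set P := ∏ p ∈ f.primeFactors, (p : ℂ) ^ (M.factorization p + δ p) with hP
  have hquot : gaussSum' f φ⁻¹ / gaussSum' n ξ⁻¹
      = gaussSum' f φ⁻¹ * (ξ⁻¹ (-1) * gaussSum' n ξ) / n := by
    rw [div_eq_div_iff hτ0 hnC, ← hτ]; ring
  have hkey : 12 * β = (gaussSum' f φ⁻¹ * gaussSum' n ξ * ξ⁻¹ (-1) * Φ * P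
      * (∏ p ∈ S, ((p : ℂ) ^ 2 - g p)) * (r * k ^ 3))
      * ((f * ∏ p ∈ A, ((p : ℂ) ^ 2 - g p)) * (3 * (n * B2 n ξ⁻¹))) := by
    rw [hβ, hprod, hquot, ← hEA, ← hES, hkC]
    exact final_algebra _ _ _ _ _ _ _ _ _ _ _ _ hnC
  have hV : gaussSum' f φ⁻¹ * gaussSum' n ξ * ξ⁻¹ (-1) * Φ * P
      * (∏ p ∈ S, ((p : ℂ) ^ 2 - g p)) * (r * k ^ 3) ∈ R :=
    R.mul_mem (R.mul_mem (R.mul_mem (R.mul_mem (R.mul_mem (R.mul_mem hg1 hg2) (hξiR _)) hΦR) hPR)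
      (hU S)) (R.mul_mem (natCast_mem R r) (R.pow_mem (natCast_mem R k) 3))
  rw [hkey]
  refine R.mul_mem hV ?_
  rcases Nat.lt_or_ge 1 n with h1 | h1
  · have hξ1 : ξ⁻¹ ≠ 1 := by
      intro h
      have h' : ξ = 1 := inv_eq_one.1 h
      rw [h', DirichletCharacter.isPrimitive_def, DirichletCharacter.conductor_one] at hξprim
      omega
    exact R.mul_mem (R.mul_mem (natCast_mem R f) (hU A))
      (R.mul_mem (by exact_mod_cast natCast_mem R 3) (nB2_mem R n h1 ξ⁻¹ hξ1 hξiR))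
  · have hn1 : n = 1 := by omega
    subst hn1
    have hgp : ∀ p, g p = 1 := fun p => by
      rw [hg]; simp only
      rw [Subsingleton.elim ((p : ℕ) : ZMod 1) 1, map_one]
    have hAf : A = f.primeFactors := by
      rw [hA]
      refine Finset.filter_true_of_mem fun p hp h => ?_
      exact (Nat.prime_of_mem_primeFactors hp).one_lt.ne' (Nat.dvd_one.1 h)
    obtain ⟨z, hz⟩ := even_part f hf
    have hzC : (f : ℂ) * ∏ p ∈ f.primeFactors, ((p : ℂ) ^ 2 - 1) = 2 * z := by
      exact_mod_cast congrArg (Int.cast : ℤ → ℂ) hz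
    rw [B2_one, hAf]
    simp only [hgp]
    rw [hzC]
    have : (2 * (z : ℂ)) * (3 * (((1 : ℕ) : ℂ) * (1 / 6))) = z := by
      push_cast; ring
    rw [this]
    exact intCast_mem R z
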